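/- Let U, V ⊆ ℝⁿ be open sets with the closure of U compact and contained in V, and let d := dist(U, ℝⁿ ∖ V) > 0. Then there exists a C^∞ function φ : ℝⁿ → ℝ with 0 ≤ φ ≤ 1, φ ≡ 1 on a neighborhood of the closure of U, φ ≡ 0 outside V (i.e. supp φ ⊆ V), and ‖∇φ(x)‖ ≤ 2/d for every x ∈ ℝⁿ. -/

import Mathlib

open Metric

section Mollification

open MeasureTheory
open scoped Convolution

variable {E : Type*} [NormedAddCommGroup E] [InnerProductSpace ℝ E] [FiniteDimensional ℝ E]

theorem norm_gradient_le_of_lipschitzWith {f : E → ℝ} {C : NNReal} (hf : LipschitzWith C f)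
    (x : E) : ‖gradient f x‖ ≤ C := by
  rw [gradient, LinearIsometryEquiv.norm_map]
  exact norm_fderiv_le_of_lipschitz ℝ hf

variable [MeasurableSpace E] {μ : Measure E}

theorem ContDiffBump.normed_convolution_apply (ψ : ContDiffBump (0 : E)) (g : E → ℝ) (x : E) :
    (ψ.normed μ ⋆[ContinuousLinearMap.lsmul ℝ ℝ, μ] g) x
      = ∫ t, ψ.normed μ t * g (x - t) ∂μ := by
  simp [MeasureTheory.convolution]

variable [BorelSpace E] [μ.IsAddHaarMeasure]

theorem ContDiffBump.integrable_normed_mul_comp_sub (ψ : ContDiffBump (0 : E)) {g : E → ℝ}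
    (hg : Continuous g) (x : E) : Integrable (fun t => ψ.normed μ t * g (x - t)) μ :=
  (ψ.continuous_normed.mul
    (hg.comp (continuous_const.sub continuous_id))).integrable_of_hasCompactSupport
    ψ.hasCompactSupport_normed.mul_right

theorem ContDiffBump.normed_convolution_mem_Icc (ψ : ContDiffBump (0 : E)) {g : E → ℝ} {a b : ℝ}
    (hg : Continuous g) (hab : ∀ x, g x ∈ Set.Icc a b) (x : E) :
    (ψ.normed μ ⋆[ContinuousLinearMap.lsmul ℝ ℝ, μ] g) x ∈ Set.Icc a b := by
  have hconst (c : ℝ) : ∫ t, ψ.normed μ t * c ∂μ = c := by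
    rw [integral_mul_const, ψ.integral_normed, one_mul]
  have hint (c : ℝ) : Integrable (fun t => ψ.normed μ t * c) μ := ψ.integrable_normed.mul_const c
  rw [ψ.normed_convolution_apply]
  constructor
  · rw [← hconst a]
    exact integral_mono (hint a) (ψ.integrable_normed_mul_comp_sub hg x)
      fun t => mul_le_mul_of_nonneg_left (hab _).1 (ψ.nonneg_normed t)
  · rw [← hconst b]
    exact integral_mono (ψ.integrable_normed_mul_comp_sub hg x) (hint b)
      fun t => mul_le_mul_of_nonneg_left (hab _).2 (ψ.nonneg_normed t)

theorem LipschitzWith.normed_convolution (ψ : ContDiffBump (0 : E)) {g : E → ℝ} {C : NNReal}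
    (hg : LipschitzWith C g) :
    LipschitzWith C (ψ.normed μ ⋆[ContinuousLinearMap.lsmul ℝ ℝ, μ] g) := by
  refine LipschitzWith.of_le_add_mul C fun x y => ?_
  rw [ψ.normed_convolution_apply, ψ.normed_convolution_apply]
  have hconst : ∫ t, ψ.normed μ t * (C * dist x y) ∂μ = C * dist x y := by
    rw [integral_mul_const, ψ.integral_normed, one_mul]
  have hint := ψ.integrable_normed_mul_comp_sub (μ := μ) hg.continuous
  have hint' : Integrable (fun t => ψ.normed μ t * (C * dist x y)) μ :=
    ψ.integrable_normed.mul_const _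
  rw [← hconst, ← integral_add (hint y) hint']
  refine integral_mono (hint x) ((hint y).add hint') fun t => ?_
  have h := hg.le_add_mul (x - t) (y - t)
  rw [dist_sub_right] at h
  simpa only [Pi.add_apply, mul_add] using mul_le_mul_of_nonneg_left h (ψ.nonneg_normed t)

end Mollification

/-- Existence of a smooth cut-off function between `U` and `V` with gradient bounded by
`2 / dist(U, ℝⁿ ∖ V)`. -/
theorem exists_cutoff_with_gradient_bound
    (n : ℕ) (U V : Set (EuclideanSpace ℝ (Fin n)))
    (hU : IsOpen U) (hV : IsOpen V)
    (hUcomp : IsCompact (closure U)) (hUV : closure U ⊆ V)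
    (d : ℝ) (hd : d = sInf {r : ℝ | ∃ x ∈ U, ∃ y ∈ Vᶜ, r = dist x y})
    (hd0 : 0 < d) :
    ∃ φ : EuclideanSpace ℝ (Fin n) → ℝ,
      ContDiff ℝ (⊤ : ℕ∞) φ ∧
      (∀ x, φ x ∈ Set.Icc (0 : ℝ) 1) ∧
      (∃ W : Set (EuclideanSpace ℝ (Fin n)), IsOpen W ∧ closure U ⊆ W ∧ Set.EqOn φ 1 W) ∧
      tsupport φ ⊆ V ∧
      ∀ x, ‖gradient φ x‖ ≤ 2 / d := by
  have hne : U.Nonempty := by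
    by_contra h
    rw [Set.not_nonempty_iff_eq_empty] at h
    simp [h] at hd
    exact hd0.ne' hd
  have hdV : ∀ y ∉ V, d ≤ infDist y U := fun y hy => by
    refine (le_infDist hne).2 fun x hx => ?_
    rw [hd, dist_comm]
    refine csInf_le ⟨0, ?_⟩ ⟨x, hx, y, hy, rfl⟩
    rintro r ⟨u, -, v, -, rfl⟩
    exact dist_nonneg
  -- The piecewise linear profile of the distance to `U` leaves a margin for mollification.
  let g : EuclideanSpace ℝ (Fin n) → ℝ := fun x => max 0 (min 1 (3 / 2 - 2 / d * infDist x U))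
  have hgIcc : ∀ x, g x ∈ Set.Icc (0 : ℝ) 1 := fun x =>
    ⟨le_max_left _ _, max_le zero_le_one (min_le_left _ _)⟩
  have hg1 : ∀ x, infDist x U ≤ d / 4 → g x = 1 := fun x hx => by
    have h : 2 / d * infDist x U ≤ 1 / 2 := by
      rw [div_mul_eq_mul_div, div_le_iff₀ hd0]; linarith
    simp only [g]
    rw [min_eq_left (by linarith), max_eq_right zero_le_one]
  have hg0 : ∀ x, 3 * d / 4 ≤ infDist x U → g x = 0 := fun x hx => by
    have h : 3 / 2 ≤ 2 / d * infDist x U := by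
      rw [div_mul_eq_mul_div, le_div_iff₀ hd0]; linarith
    exact max_eq_left ((min_le_right _ _).trans (by linarith))
  have hgLip : LipschitzWith (2 / d).toNNReal g := by
    refine LipschitzWith.const_max (LipschitzWith.const_min ?_ 1) 0
    refine LipschitzWith.of_le_add_mul _ fun x y => ?_
    rw [Real.coe_toNNReal _ (by positivity)]
    have h := mul_le_mul_of_nonneg_left (infDist_le_infDist_add_dist (x := y) (y := x) (s := U))
      (by positivity : 0 ≤ 2 / d)
    rw [mul_add, dist_comm] at h
    linarith
  let ψ : ContDiffBump (0 : EuclideanSpace ℝ (Fin n)) :=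
    ⟨d / 16, d / 8, by positivity, by linarith⟩
  have hdist : ∀ x, ∀ y ∈ ball x ψ.rOut,
      infDist y U ≤ infDist x U + d / 8 ∧ infDist x U ≤ infDist y U + d / 8 := fun x y hy => by
    have hxy : dist y x < d / 8 := hy
    have h₁ := infDist_le_infDist_add_dist (x := y) (y := x) (s := U)
    have h₂ := infDist_le_infDist_add_dist (x := x) (y := y) (s := U)
    rw [dist_comm x y] at h₂
    constructor <;> linarith
  let φ := MeasureTheory.convolution (ψ.normed MeasureTheory.volume) g (ContinuousLinearMap.lsmul ℝ ℝ)
    MeasureTheory.volume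
  have hφ1 : ∀ x, infDist x U < d / 8 → φ x = 1 := fun x hx => by
    have hx1 : g x = 1 := hg1 x (by linarith)
    rw [← hx1]
    refine ψ.normed_convolution_eq_right fun y hy => ?_
    rw [hx1, hg1 y (by linarith [(hdist x y hy).1])]
  have hφ0 : ∀ x, 7 * d / 8 < infDist x U → φ x = 0 := fun x hx => by
    have hx0 : g x = 0 := hg0 x (by linarith)
    rw [← hx0]
    refine ψ.normed_convolution_eq_right fun y hy => ?_
    rw [hx0, hg0 y (by linarith [(hdist x y hy).2])]
  refine ⟨φ, ?_, ψ.normed_convolution_mem_Icc hgLip.continuous hgIcc,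
    ⟨{x | infDist x U < d / 8}, isOpen_lt (continuous_infDist_pt U) continuous_const, ?_, hφ1⟩,
    ?_, fun x => ?_⟩
  · exact ψ.hasCompactSupport_normed.contDiff_convolution_left _ ψ.contDiff_normed
      hgLip.continuous.locallyIntegrable
  · intro x hx
    have h : infDist x U = 0 := (mem_closure_iff_infDist_zero hne).1 hx
    simp only [Set.mem_ofPred_eq, h]
    positivity
  · have hsub : tsupport φ ⊆ {x | infDist x U ≤ 7 * d / 8} :=
      closure_minimal (fun x hx => not_lt.1 fun h => hx (hφ0 x h))
        (isClosed_le (continuous_infDist_pt U) continuous_const)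
    intro x hx
    by_contra hxV
    have h₁ : infDist x U ≤ 7 * d / 8 := hsub hx
    linarith [hdV x hxV]
  · have h := norm_gradient_le_of_lipschitzWith
      (hgLip.normed_convolution (μ := MeasureTheory.volume) ψ) x
    rwa [Real.coe_toNNReal _ (by positivity)] at h
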